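/- arXiv:math/0410620 — 3 statements merged into one kernel-verified Lean document; each statement's English description precedes it below -/
import Mathlib

section
/- Let f : A → B be a ring homomorphism such that for every s : P → Q in σ, precomposition with s induces a bijection Hom_A(Q, B) → Hom_A(P, B), where B is regarded as a left A-module via f. Then f is σ-inverting; that is, for every left B-module M, regarded as an A-module via f, and every s : P → Q in σ, precomposition with s induces a bijection Hom_A(Q, M) → Hom_A(P, M) (equivalently, 1 ⊗ s : B ⊗_A P → B ⊗_A Q is bijective). -/
universe u v w x

open Function

variable {A : Type u} [Ring A]
variable {ι : Type v} {P Q : ι → Type w}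
  [∀ i, AddCommGroup (P i)] [∀ i, Module A (P i)]
  [∀ i, AddCommGroup (Q i)] [∀ i, Module A (Q i)]
  (s : ∀ i, P i →ₗ[A] Q i)

/-- A ring homomorphism `f : A → B` is `σ`-inverting if for every `s i : P i → Q i` in `σ`
and every left `B`-module `M`, regarded as an `A`-module via `f`, precomposition with `s i`
induces a bijection `Hom_A(Q i, M) → Hom_A(P i, M)`; this is equivalent to the bijectivity of
`1 ⊗ s i : B ⊗_A P i → B ⊗_A Q i`, since `B ⊗_A P` represents `M ↦ Hom_A(P, M)` on
left `B`-modules. -/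
def IsInverting {B : Type x} [Ring B] (f : A →+* B) : Prop :=
  ∀ (M : Type (max u w x)) [AddCommGroup M] [Module B M] (i : ι),
    letI : Module A M := Module.compHom M f
    Function.Bijective fun (g : Q i →ₗ[A] M) => g.comp (s i)

/-!
Statement 9: if `f : A → B` is a ring homomorphism such that for every `s : P → Q` in `σ`
precomposition with `s` induces a bijection `Hom_A(Q, B) → Hom_A(P, B)` (where `B` is an
`A`-module via `f`), then `f` is `σ`-inverting: the same bijectivity holds for every left
`B`-module `M`.
-/

/-- A finitely generated projective `A`-module has a finite dual basis. -/
theorem exists_dual_basis_of_projective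
    (N : Type*) [AddCommGroup N] [Module A N] [Module.Finite A N] [Module.Projective A N] :
    ∃ (n : ℕ) (p : Fin n → N) (φ : Fin n → N →ₗ[A] A), ∀ y : N, ∑ j, φ j y • p j = y := by
  obtain ⟨n, a, c, -, -, hac⟩ := Module.Finite.exists_comp_eq_id_of_projective A N
  refine ⟨n, fun j => a (Pi.single j 1), fun j => LinearMap.proj j ∘ₗ c, fun y => ?_⟩
  have h := LinearMap.congr_fun hac y
  rw [LinearMap.comp_apply, ← Finset.univ_sum_single (c y), map_sum] at h
  refine (Finset.sum_congr rfl fun j _ => ?_).trans h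
  simp [← map_smul, ← Pi.single_smul]

/-- A dual basis expands homomorphisms to a `B`-module along `B`-valued coordinates. -/
theorem map_eq_sum_toSpanSingleton_smul {N : Type*} [AddCommGroup N] [Module A N]
    {B : Type*} [Ring B] [Module A B]
    {n : ℕ} {p : Fin n → N} {φ : Fin n → N →ₗ[A] A} (h : ∀ y : N, ∑ j, φ j y • p j = y)
    {M : Type*} [AddCommGroup M] [Module A M] [Module B M] [IsScalarTower A B M]
    (g : N →ₗ[A] M) (y : N) :
    g y = ∑ j, (LinearMap.toSpanSingleton A B 1 ∘ₗ φ j) y • g (p j) := by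
  conv_lhs => rw [← h y]
  simp

/-- If precomposition with a homomorphism `t` of finitely generated projective `A`-modules is
bijective on homomorphisms to `B`, it is bijective on homomorphisms to every `B`-module. -/
theorem bijective_comp_of_bijective_comp_self
    {N N' : Type*} [AddCommGroup N] [Module A N] [Module.Finite A N] [Module.Projective A N]
    [AddCommGroup N'] [Module A N'] [Module.Finite A N'] [Module.Projective A N']
    (t : N →ₗ[A] N') {B : Type*} [Ring B] [Module A B] [IsScalarTower A B B]
    (ht : Bijective fun g : N' →ₗ[A] B => g.comp t)
    (M : Type*) [AddCommGroup M] [Module A M] [Module B M] [IsScalarTower A B M] :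
    Bijective fun g : N' →ₗ[A] M => g.comp t := by
  obtain ⟨n, p, φ, hφ⟩ := exists_dual_basis_of_projective (A := A) N
  obtain ⟨m, q, ψ, hψ⟩ := exists_dual_basis_of_projective (A := A) N'
  choose u hu using fun j => ht.2 (LinearMap.toSpanSingleton A B 1 ∘ₗ φ j)
  have hut (j : Fin n) (y : N) : u j (t y) = φ j y • (1 : B) := LinearMap.congr_fun (hu j) y
  have hexp (ψ' : N' →ₗ[A] B) (y : N') : ψ' y = ∑ j, u j y * ψ' (t (p j)) := by
    have h : ψ' = ∑ j, (LinearMap.toSpanSingleton B B (ψ' (t (p j)))).restrictScalars A ∘ₗ u j := by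
      refine ht.1 (LinearMap.ext fun z => ?_)
      simpa [hut] using map_eq_sum_toSpanSingleton_smul (B := B) hφ (ψ' ∘ₗ t) z
    simpa using LinearMap.congr_fun h y
  have hexpM (h : N' →ₗ[A] M) (y : N') : h y = ∑ j, u j y • h (t (p j)) := by
    have hψM := map_eq_sum_toSpanSingleton_smul (B := B) hψ h
    rw [hψM y]
    simp_rw [hψM (t _), hexp (_ ∘ₗ ψ _) y, Finset.sum_smul, Finset.smul_sum, mul_smul]
    exact Finset.sum_comm
  constructor
  · intro g h hgh
    ext y
    rw [hexpM g, hexpM h]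
    exact Finset.sum_congr rfl fun j _ => congrArg _ (LinearMap.congr_fun hgh (p j))
  · intro g
    refine ⟨∑ j, (LinearMap.toSpanSingleton B M (g (p j))).restrictScalars A ∘ₗ u j, ?_⟩
    ext z
    simpa [hut] using (map_eq_sum_toSpanSingleton_smul (B := B) hφ g z).symm

theorem isInverting_of_self
    [∀ i, Module.Finite A (P i)] [∀ i, Module.Projective A (P i)]
    [∀ i, Module.Finite A (Q i)] [∀ i, Module.Projective A (Q i)]
    {B : Type x} [Ring B] (f : A →+* B)
    (hB : letI : Module A B := Module.compHom B f
      ∀ i : ι, Function.Bijective fun (g : Q i →ₗ[A] B) => g.comp (s i)) :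
    IsInverting s f := by
  intro M _ _ i
  let : Module A B := Module.compHom B f
  let : Module A M := Module.compHom M f
  have : IsScalarTower A B B := ⟨fun a b c => mul_assoc (f a) b c⟩
  have : IsScalarTower A B M := ⟨fun a b m => mul_smul (f a) b m⟩
  exact bijective_comp_of_bijective_comp_self (s i) (hB i) M
end

section
/- Let θ : A → σ⁻¹A be a universal σ-inverting ring homomorphism, and let M be a left A-module such that for every s : P → Q in σ, precomposition with s induces a bijection Hom_A(Q, M) → Hom_A(P, M). Then M admits a unique σ⁻¹A-module structure whose restriction of scalars along θ is the given A-module structure. -/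
universe u v w x

open Function

variable {A : Type u} [Ring A]
variable {ι : Type v} {P Q : ι → Type w}
  [∀ i, AddCommGroup (P i)] [∀ i, Module A (P i)]
  [∀ i, AddCommGroup (Q i)] [∀ i, Module A (Q i)]
  (s : ∀ i, P i →ₗ[A] Q i)

/-- The scalar multiplication associated to a (possibly non-canonical) module structure `m`. -/
def smulOf {B H : Type*} [Semiring B] [AddCommMonoid H] (m : Module B H) (b : B) (h : H) : H :=
  letI := m
  b • h

/-!
Statement 11: let `θ : A → σ⁻¹A` be a universal `σ`-inverting ring homomorphism and let `M` be
a left `A`-module such that precomposition with each `s : P → Q` in `σ` induces a bijection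
`Hom_A(Q, M) → Hom_A(P, M)`.  Then `M` admits a unique `σ⁻¹A`-module structure whose
restriction of scalars along `θ` is the given `A`-module structure.
-/

/-- A finitely generated projective module has a finite dual basis. -/
theorem exists_finite_dual_basis (R L : Type*) [Ring R] [AddCommGroup L] [Module R L]
    [Module.Finite R L] [Module.Projective R L] :
    ∃ (n : ℕ) (p : Fin n → L) (φ : Fin n → L →ₗ[R] R), ∀ y, ∑ j, φ j y • p j = y := by
  obtain ⟨n, f, g, -, -, h⟩ := Module.Finite.exists_comp_eq_id_of_projective R L
  refine ⟨n, fun j => f (Pi.single j 1), fun j => (LinearMap.proj j).comp g, fun y => ?_⟩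
  calc ∑ j, g y j • f (Pi.single j 1) = f (∑ j, g y j • Pi.single j 1) := by simp
    _ = f (g y) := by rw [← pi_eq_sum_univ' (g y)]
    _ = y := LinearMap.congr_fun h y

/-- If precomposition with a map `t` of finitely generated projective `R`-modules is bijective on
maps to a ring `C` over `R`, then it is bijective on maps to every `C`-module. -/
theorem bijective_comp_of_bijective_comp_ring {R L K C N : Type*} [Ring R]
    [AddCommGroup L] [Module R L] [Module.Finite R L] [Module.Projective R L]
    [AddCommGroup K] [Module R K] [Module.Finite R K] [Module.Projective R K]
    [Ring C] [Module R C] [IsScalarTower R C C]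
    [AddCommGroup N] [Module R N] [Module C N] [IsScalarTower R C N] (t : L →ₗ[R] K)
    (ht : Bijective fun g : K →ₗ[R] C => g.comp t) :
    Bijective fun g : K →ₗ[R] N => g.comp t := by
  obtain ⟨n, p, φ, hφ⟩ := exists_finite_dual_basis R L
  obtain ⟨m, q, ψ, hψ⟩ := exists_finite_dual_basis R K
  have hex (j : Fin n) : ∃ f : K →ₗ[R] C, ∀ y, f (t y) = φ j y • (1 : C) := by
    obtain ⟨f, hf⟩ := ht.2 ((LinearMap.toSpanSingleton R C 1).comp (φ j))
    exact ⟨f, fun y => LinearMap.congr_fun hf y⟩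
  choose φ' hφ' using hex
  have expand_ring (f : K →ₗ[R] C) (y : K) : f y = ∑ j, φ' j y * f (t (p j)) := by
    have h : f = ∑ j, (LinearMap.toSpanSingleton C C (f (t (p j)))).restrictScalars R ∘ₗ φ' j := by
      apply ht.1
      ext z
      simp only [LinearMap.comp_apply, LinearMap.sum_apply, LinearMap.restrictScalars_apply,
        LinearMap.toSpanSingleton_apply, hφ', smul_assoc, one_smul]
      conv_lhs => rw [← hφ z]
      simp
    conv_lhs => rw [h]
    simp
  have expand (f : K →ₗ[R] N) (y : K) : f y = ∑ j, φ' j y • f (t (p j)) := by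
    have hf (z : K) : f z = ∑ k, (ψ k z • (1 : C)) • f (q k) := by
      conv_lhs => rw [← hψ z]
      simp
    rw [hf y]
    simp_rw [hf (t _), Finset.smul_sum, ← mul_smul]
    rw [Finset.sum_comm]
    simp_rw [← Finset.sum_smul]
    refine Finset.sum_congr rfl fun k _ => ?_
    congr 1
    exact expand_ring ((LinearMap.toSpanSingleton R C 1).comp (ψ k)) y
  refine ⟨fun f f' h => ?_, fun g => ?_⟩
  · ext y
    rw [expand f, expand f']
    exact Finset.sum_congr rfl fun j _ => congrArg _ (LinearMap.congr_fun h (p j))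
  · refine ⟨∑ j, (LinearMap.toSpanSingleton C N (g (p j))).restrictScalars R ∘ₗ φ' j, ?_⟩
    ext z
    simp only [LinearMap.comp_apply, LinearMap.sum_apply, LinearMap.restrictScalars_apply,
      LinearMap.toSpanSingleton_apply, hφ', smul_assoc, one_smul]
    conv_rhs => rw [← hφ z]
    simp

/-- If precomposition with `t` is bijective on maps to `M`, then it is bijective on maps to any
module `C` whose elements are identified with the additive endomorphisms of `M`. -/
theorem bijective_comp_of_addEquiv_end {R L K M C : Type*} [Ring R]
    [AddCommGroup L] [Module R L] [AddCommGroup K] [Module R K]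
    [AddCommGroup M] [Module R M] [AddCommGroup C] [Module R C] (e : C ≃+ (M →+ M))
    (he : ∀ (r : R) (c : C) (x : M), e (r • c) x = r • e c x) (t : L →ₗ[R] K)
    (ht : Bijective fun g : K →ₗ[R] M => g.comp t) :
    Bijective fun g : K →ₗ[R] C => g.comp t := by
  let ev (x : M) : C →ₗ[R] M :=
    { toFun := fun c => e c x
      map_add' := fun c d => by simp
      map_smul' := fun r c => he r c x }
  refine ⟨fun f f' h => ?_, fun g => ?_⟩
  · ext y
    apply e.injective
    ext x
    have hx : (ev x).comp f = (ev x).comp f' :=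
      ht.1 (LinearMap.ext fun z => congrArg (ev x) (LinearMap.congr_fun h z))
    exact LinearMap.congr_fun hx y
  · choose G hG using fun x => ht.2 ((ev x).comp g)
    have hG' (x : M) (z : L) : G x (t z) = e (g z) x := LinearMap.congr_fun (hG x) z
    have hadd (x y : M) : G (x + y) = G x + G y := by
      apply ht.1
      ext z
      simp [hG']
    let F (y : K) : M →+ M := AddMonoidHom.mk' (fun x => G x y) fun x x' => by simp [hadd]
    refine ⟨{ toFun := fun y => e.symm (F y), map_add' := fun y y' => ?_,
              map_smul' := fun r y => ?_ }, ?_⟩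
    · rw [← map_add]
      congr 1
      ext x
      simp [F]
    · apply e.injective
      ext x
      simp [F, he]
    · ext z
      apply e.injective
      ext x
      simp [F, hG']

/-- If `M` sees every map in `σ` as invertible, then the action of `A` on `M` defines a
`σ`-inverting homomorphism to any copy of the ring of additive endomorphisms of `M`. -/
theorem isInverting_toAddMonoidEnd
    [∀ i, Module.Finite A (P i)] [∀ i, Module.Projective A (P i)]
    [∀ i, Module.Finite A (Q i)] [∀ i, Module.Projective A (Q i)]
    {M C : Type*} [AddCommGroup M] [Module A M] [Ring C] (e : C ≃+* AddMonoid.End M)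
    (hM : ∀ i : ι, Function.Bijective fun (g : Q i →ₗ[A] M) => g.comp (s i)) :
    IsInverting s (e.symm.toRingHom.comp (Module.toAddMonoidEnd A M)) := by
  intro N _ _ i
  let g : A →+* C := e.symm.toRingHom.comp (Module.toAddMonoidEnd A M)
  let _ : Module A C := Module.compHom C g
  let _ : Module A N := Module.compHom N g
  have : IsScalarTower A C C := ⟨fun a c d => mul_assoc (g a) c d⟩
  have : IsScalarTower A C N := ⟨fun a c d => mul_smul (g a) c d⟩
  refine bijective_comp_of_bijective_comp_ring (C := C) (s i)
    (bijective_comp_of_addEquiv_end (M := M) e.toAddEquiv (fun a c x => ?_) (s i) (hM i))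
  change e (e.symm (Module.toAddMonoidEnd A M a) * c) x = a • e c x
  rw [map_mul, e.apply_symm_apply]
  rfl

theorem unique_module_structure_of_local_module
    [∀ i, Module.Finite A (P i)] [∀ i, Module.Projective A (P i)]
    [∀ i, Module.Finite A (Q i)] [∀ i, Module.Projective A (Q i)]
    {B : Type x} [Ring B] (θ : A →+* B)
    (hθ : IsInverting s θ)
    (hUniv : ∀ (C : Type (max u v w x)) (_ : Ring C) (g : A →+* C), IsInverting s g →
      ∃! h : B →+* C, h.comp θ = g)
    (M : Type (max u w x)) [AddCommGroup M] [Module A M]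
    (hM : ∀ i : ι, Function.Bijective fun (g : Q i →ₗ[A] M) => g.comp (s i)) :
    ∃! m : Module B M, ∀ (a : A) (x : M), smulOf m (θ a) x = a • x := by
  let C := ULift.{max u v w x} (AddMonoid.End M)
  let e : C ≃+* AddMonoid.End M := ULift.ringEquiv
  let g : A →+* C := e.symm.toRingHom.comp (Module.toAddMonoidEnd A M)
  obtain ⟨h, hh, huniq⟩ := hUniv C inferInstance g (isInverting_toAddMonoidEnd s e hM)
  refine ⟨Module.compHom M (e.toRingHom.comp h), fun a y => ?_, fun m hm => ?_⟩
  · exact congrArg (fun c => e c y) (RingHom.congr_fun hh a)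
  · have key : e.symm.toRingHom.comp (@Module.toAddMonoidEnd B M _ _ m) = h := by
      apply huniq
      refine RingHom.ext fun a => e.injective (AddMonoidHom.ext fun y => ?_)
      exact hm a y
    refine Module.ext' _ _ fun b y => ?_
    exact congrArg (fun c => e c y) (RingHom.congr_fun key b)
end

section
/- Let θ : A → σ⁻¹A be a universal σ-inverting ring homomorphism and let g : A → C be any σ-inverting ring homomorphism. Regard σ⁻¹A as a left A-module via θ and C as a left A-module via g. Then there is exactly one A-linear map h : σ⁻¹A → C with h ∘ θ = g; that is, the factorization of g through θ is unique even among maps of left A-modules. -/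
universe u v w x

open Function

variable {A : Type u} [Ring A]
variable {ι : Type v} {P Q : ι → Type w}
  [∀ i, AddCommGroup (P i)] [∀ i, Module A (P i)]
  [∀ i, AddCommGroup (Q i)] [∀ i, Module A (Q i)]
  (s : ∀ i, P i →ₗ[A] Q i)

/-!
Statement 16: let `θ : A → σ⁻¹A` be a universal `σ`-inverting ring homomorphism and let
`g : A → C` be any `σ`-inverting ring homomorphism.  Regarding `σ⁻¹A` and `C` as left
`A`-modules via `θ` and `g` respectively, there is exactly one `A`-linear map
`h : σ⁻¹A → C` with `h ∘ θ = g`.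
-/

/-- Inverting `s` for the modules of one universe suffices for the modules of every universe:
homomorphisms out of `P i` and `Q i` land in small submodules. -/
theorem IsInverting.bijective_comp {B : Type x} [Ring B] {f : A →+* B} (hf : IsInverting s f)
    {M : Type*} [AddCommGroup M] [Module B M] [Module A M]
    (compat : ∀ (a : A) (m : M), a • m = f a • m) (i : ι) :
    Function.Bijective fun (g : Q i →ₗ[A] M) => g.comp (s i) := by
  have small_case : ∀ (N : Submodule B M) [Small.{max u w x} N],
      letI : Module A N := Module.compHom N f
      Function.Bijective fun (g : Q i →ₗ[A] N) => g.comp (s i) := by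
    intro N _
    let : Module A N := Module.compHom N f
    let : Module A (Shrink.{max u w x} N) := Module.compHom (Shrink.{max u w x} N) f
    let e₀ : Shrink.{max u w x} N ≃ₗ[B] N := Shrink.linearEquiv B N
    let e : Shrink.{max u w x} N ≃ₗ[A] N :=
      { e₀ with map_smul' := fun a n => e₀.map_smul (f a) n }
    have h := hf (Shrink.{max u w x} N) i
    constructor
    · intro g₁ g₂ hg
      have key : (e.symm.toLinearMap.comp g₁) = e.symm.toLinearMap.comp g₂ := by
        refine h.1 (LinearMap.ext fun p => ?_)
        exact congrArg e.symm (LinearMap.congr_fun hg p)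
      ext q
      exact congrArg Subtype.val (e.symm.injective (LinearMap.congr_fun key q))
    · intro p
      obtain ⟨g, hg⟩ := h.2 (e.symm.toLinearMap.comp p)
      refine ⟨e.toLinearMap.comp g, LinearMap.ext fun z => ?_⟩
      have := congrArg e (LinearMap.congr_fun hg z)
      exact this.trans (e.apply_symm_apply (p z))
  have lift : ∀ {T : Type w} [AddCommGroup T] [Module A T] (N : Submodule B M) (g : T →ₗ[A] M),
      (∀ t, g t ∈ N) →
      letI : Module A N := Module.compHom N f
      ∃ g' : T →ₗ[A] N, ∀ t, (g' t : M) = g t := by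
    intro T _ _ N g hg
    let : Module A N := Module.compHom N f
    exact ⟨{ toFun := fun t => ⟨g t, hg t⟩
             map_add' := fun a b => Subtype.ext (g.map_add a b)
             map_smul' := fun a t => Subtype.ext ((g.map_smul a t).trans (compat a (g t))) },
      fun _ => rfl⟩
  have small_span : ∀ S : Set M, Small.{max u w x} S →
      Small.{max u w x} (Submodule.span B S) := by
    intro S _
    rw [Finsupp.span_eq_range_linearCombination]
    have : Small.{max u w x} (S →₀ B) :=
      have : Small.{max u w x} B := small_max.{max u w} B
      small_of_injective (DFunLike.coe_injective (F := S →₀ B))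
    exact small_of_surjective
      (LinearMap.surjective_rangeRestrict (Finsupp.linearCombination B ((↑) : S → M)))
  constructor
  · intro g₁ g₂ hg
    have := small_lift.{w, w, max u w x} (Q i)
    let N := Submodule.span B (Set.range g₁ ∪ Set.range g₂)
    let : Module A N := Module.compHom N f
    have : Small.{max u w x} N := small_span _ inferInstance
    obtain ⟨k₁, hk₁⟩ := lift N g₁ fun t => Submodule.subset_span (.inl ⟨t, rfl⟩)
    obtain ⟨k₂, hk₂⟩ := lift N g₂ fun t => Submodule.subset_span (.inr ⟨t, rfl⟩)
    have key : k₁ = k₂ := (small_case N).1 <| LinearMap.ext fun p => Subtype.ext <| by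
      simpa [hk₁, hk₂] using LinearMap.congr_fun hg p
    ext q
    rw [← hk₁, ← hk₂, key]
  · intro p
    let N := Submodule.span B (Set.range p)
    let : Module A N := Module.compHom N f
    have : Small.{max u w x} N := small_span _ inferInstance
    obtain ⟨k, hk⟩ := lift N p fun t => Submodule.subset_span ⟨t, rfl⟩
    obtain ⟨g, hg⟩ := (small_case N).2 k
    refine ⟨{ toFun := fun q => g q
              map_add' := fun a b => by simp
              map_smul' := fun a q => ?_ }, LinearMap.ext fun z => ?_⟩
    · rw [map_smul]
      exact (compat a (g q)).symm
    · exact (congrArg Subtype.val (LinearMap.congr_fun hg z)).trans (hk z)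

/-- Postcomposing an inverting ring homomorphism with any ring homomorphism is inverting. -/
theorem IsInverting.comp {B : Type x} [Ring B] {f : A →+* B} (hf : IsInverting s f)
    {E : Type*} [Ring E] (α : B →+* E) : IsInverting s (α.comp f) := by
  intro M _ _ i
  let : Module A M := Module.compHom M (α.comp f)
  let : Module B M := Module.compHom M α
  exact hf.bijective_comp s (fun _ _ => rfl) i

/-- If ring homomorphisms out of `B` are determined by their composite with `θ`, then every
`θ`-semilinear additive map from `B` to a `B`-module is `B`-linear. -/
theorem map_eq_smul_map_one_of_hom_unique {B : Type x} [Ring B] (θ : A →+* B)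
    {M : Type*} [AddCommGroup M] [Module B M]
    (huniq : ∀ α β : B →+* AddMonoid.End (B × M), α.comp θ = β.comp θ → α = β)
    (f : B →+ M) (hf : ∀ a b, f (θ a * b) = θ a • f b) (b : B) : f b = b • f 1 := by
  let n : AddMonoid.End (B × M) :=
    (AddMonoidHom.inr B M).comp (f.comp (AddMonoidHom.fst B M))
  have hn : n * n = 0 := by
    refine AddMonoidHom.ext fun z => ?_
    change ((0 : B), f 0) = 0
    simp
  let U : (AddMonoid.End (B × M))ˣ :=
    ⟨1 - n, 1 + n, by simp [sub_mul, mul_add, hn], by simp [add_mul, mul_sub, hn]⟩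
  let α : B →+* AddMonoid.End (B × M) := Module.toAddMonoidEnd B (B × M)
  let β : B →+* AddMonoid.End (B × M) :=
    (MulSemiringAction.toRingHom (ConjAct (AddMonoid.End (B × M))ˣ) _ (ConjAct.toConjAct U)).comp α
  have hβ : ∀ b z, β b z = (b • z.1, b • (z.2 + f z.1) - f (b • z.1)) := fun b z => by
    change b • (z + (0, f z.1)) - (0, f (b • (z + (0, f z.1))).1) = _
    ext <;> simp
  have h : α = β := huniq α β <| RingHom.ext fun a => AddMonoidHom.ext fun z => by
    change θ a • z = β (θ a) z
    rw [hβ]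
    ext <;> simp [hf]
  have h1 : b • ((1, 0) : B × M) = β b (1, 0) := by rw [← h]; rfl
  rw [hβ] at h1
  have h2 : b • (0 : M) = b • (0 + f 1) - f (b • 1) := congrArg Prod.snd h1
  rw [smul_zero, zero_add, smul_eq_mul, mul_one] at h2
  exact (sub_eq_zero.mp h2.symm).symm

theorem unique_A_linear_factorization
    [∀ i, Module.Finite A (P i)] [∀ i, Module.Projective A (P i)]
    [∀ i, Module.Finite A (Q i)] [∀ i, Module.Projective A (Q i)]
    {B : Type x} [Ring B] (θ : A →+* B)
    (hθ : IsInverting s θ)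
    (hUniv : ∀ (C : Type (max u v w x)) (_ : Ring C) (g : A →+* C), IsInverting s g →
      ∃! h : B →+* C, h.comp θ = g)
    {C : Type (max u v w x)} [Ring C] (g : A →+* C) (hg : IsInverting s g) :
    letI : Module A B := Module.compHom B θ
    letI : Module A C := Module.compHom C g
    ∃! h : B →ₗ[A] C, ∀ a : A, h (θ a) = g a := by
  let : Module A B := Module.compHom B θ
  let : Module A C := Module.compHom C g
  obtain ⟨h₀, hh₀, -⟩ := hUniv C _ g hg
  have hθg : ∀ a, h₀ (θ a) = g a := fun a => RingHom.congr_fun hh₀ a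
  refine ⟨{ h₀ with map_smul' := fun a b => ?_ }, hθg, fun h hh => LinearMap.ext fun b => ?_⟩
  · exact (h₀.map_mul (θ a) b).trans (congrArg (· * h₀ b) (hθg a))
  · let : Module B C := Module.compHom C h₀
    have key := map_eq_smul_map_one_of_hom_unique θ (M := C)
      (fun α β hαβ => (hUniv _ _ (β.comp θ) (hθ.comp s β)).unique hαβ rfl)
      h.toAddMonoidHom
      (fun a b => (h.map_smul a b).trans (congrArg (· * h b) (hθg a).symm)) b
    have h1 : h 1 = 1 := by simpa using hh 1
    exact key.trans ((congrArg (h₀ b * ·) h1).trans (mul_one _))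
end
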